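/- From every configuration (s0, s0', d) with d(l1) = d(l2) = 0: (i) there is exactly one maximal interleaved run, in which the transitions fire in the order: l1<-1 (by gamma2), the guard l1=1 (by gamma1), x<-m (by gamma1), l2<-1 (by gamma1), the guard l2=1 (by gamma2), the guard x=m (by gamma2), l1<-0 (by gamma2), the guard l1=0 (by gamma1), l2<-0 (by gamma1), the guard l2=0 (by gamma2); and (ii) in every interleaved run in which gamma2 reaches s5', gamma1 reaches s5 and the guard x=m is fired after the assignment x<-m. -/

import Mathlib

/-- A run `c0 = cs 0, ls 0, cs 1, ls 1, …, cs n` of a labeled transition relation. -/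
def IsRun {C L : Type} (step : C → L → C → Prop) (c0 : C) (n : ℕ)
    (cs : ℕ → C) (ls : ℕ → L) : Prop :=
  cs 0 = c0 ∧ ∀ i < n, step (cs i) (ls i) (cs (i + 1))

/-- A configuration of the two interleaved processes `γ₁` (local states `s0,…,s5`,
coded as `g1 : Fin 6`) and `γ₂` (local states `s0',…,s5'`, coded as `g2 : Fin 6`),
together with the shared variables `l1, l2 : Bool` and `x : M`. -/
structure RdvCfg (M : Type) : Type where
  g1 : Fin 6
  g2 : Fin 6
  l1 : Bool
  l2 : Bool
  x : M

/-- Which process fires a transition. -/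
inductive Who : Type
  | p1
  | p2
deriving DecidableEq

/-- The interleaved semantics of
`γ₁ : s0 -[l1=1]→ s1 -[x←m]→ s2 -[l2←1]→ s3 -[l1=0]→ s4 -[l2←0]→ s5` and
`γ₂ : s0' -[l1←1]→ s1' -[l2=1]→ s2' -[x=m]→ s3' -[l1←0]→ s4' -[l2=0]→ s5'`:
at each step one process fires its next transition; guards are enabled iff they hold
of the current valuation; assignments update the valuation. -/
inductive RdvStep (M : Type) (m : M) : RdvCfg M → Who → RdvCfg M → Prop
  | g1_guard_l1 (c : RdvCfg M) :
      c.g1 = 0 → c.l1 = true → RdvStep M m c Who.p1 { c with g1 := 1 }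
  | g1_set_x (c : RdvCfg M) :
      c.g1 = 1 → RdvStep M m c Who.p1 { c with g1 := 2, x := m }
  | g1_set_l2 (c : RdvCfg M) :
      c.g1 = 2 → RdvStep M m c Who.p1 { c with g1 := 3, l2 := true }
  | g1_guard_l1z (c : RdvCfg M) :
      c.g1 = 3 → c.l1 = false → RdvStep M m c Who.p1 { c with g1 := 4 }
  | g1_clear_l2 (c : RdvCfg M) :
      c.g1 = 4 → RdvStep M m c Who.p1 { c with g1 := 5, l2 := false }
  | g2_set_l1 (c : RdvCfg M) :
      c.g2 = 0 → RdvStep M m c Who.p2 { c with g2 := 1, l1 := true }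
  | g2_guard_l2 (c : RdvCfg M) :
      c.g2 = 1 → c.l2 = true → RdvStep M m c Who.p2 { c with g2 := 2 }
  | g2_guard_x (c : RdvCfg M) :
      c.g2 = 2 → c.x = m → RdvStep M m c Who.p2 { c with g2 := 3 }
  | g2_clear_l1 (c : RdvCfg M) :
      c.g2 = 3 → RdvStep M m c Who.p2 { c with g2 := 4, l1 := false }
  | g2_guard_l2z (c : RdvCfg M) :
      c.g2 = 4 → c.l2 = false → RdvStep M m c Who.p2 { c with g2 := 5 }

/-- The unique scheduling of the rendezvous protocol:
`l1←1 (γ₂)`, `l1=1 (γ₁)`, `x←m (γ₁)`, `l2←1 (γ₁)`, `l2=1 (γ₂)`, `x=m (γ₂)`,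
`l1←0 (γ₂)`, `l1=0 (γ₁)`, `l2←0 (γ₁)`, `l2=0 (γ₂)`. -/
def rdvOrder : ℕ → Who
  | 0 => Who.p2
  | 1 => Who.p1
  | 2 => Who.p1
  | 3 => Who.p1
  | 4 => Who.p2
  | 5 => Who.p2
  | 6 => Who.p2
  | 7 => Who.p1
  | 8 => Who.p1
  | _ => Who.p2

/-- The configuration reached after `i` steps of the rendezvous protocol started with `x = a`. -/
def rdvTrace {M : Type} (m a : M) : ℕ → RdvCfg M
  | 0 => ⟨0, 0, false, false, a⟩
  | 1 => ⟨0, 1, true, false, a⟩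
  | 2 => ⟨1, 1, true, false, a⟩
  | 3 => ⟨2, 1, true, false, m⟩
  | 4 => ⟨3, 1, true, true, m⟩
  | 5 => ⟨3, 2, true, true, m⟩
  | 6 => ⟨3, 3, true, true, m⟩
  | 7 => ⟨3, 4, false, true, m⟩
  | 8 => ⟨4, 4, false, true, m⟩
  | 9 => ⟨5, 4, false, false, m⟩
  | _ => ⟨5, 5, false, false, m⟩

theorem rdvStep_rdvTrace {M : Type} (m a : M) {i : ℕ} (hi : i < 10) :
    RdvStep M m (rdvTrace m a i) (rdvOrder i) (rdvTrace m a (i + 1)) := by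
  interval_cases i
  · exact .g2_set_l1 _ rfl
  · exact .g1_guard_l1 _ rfl rfl
  · exact .g1_set_x _ rfl
  · exact .g1_set_l2 _ rfl
  · exact .g2_guard_l2 _ rfl rfl
  · exact .g2_guard_x _ rfl rfl
  · exact .g2_clear_l1 _ rfl
  · exact .g1_guard_l1z _ rfl rfl
  · exact .g1_clear_l2 _ rfl
  · exact .g2_guard_l2z _ rfl rfl

theorem RdvStep.eq_of_rdvTrace {M : Type} {m a : M} {i : ℕ} (hi : i ≤ 10) {w : Who}
    {c : RdvCfg M} (h : RdvStep M m (rdvTrace m a i) w c) :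
    i < 10 ∧ w = rdvOrder i ∧ c = rdvTrace m a (i + 1) := by
  interval_cases i <;> cases h <;> simp_all [rdvTrace, rdvOrder]

theorem IsRun.eq_rdvTrace {M : Type} {m a : M} {n : ℕ} {cs : ℕ → RdvCfg M} {ls : ℕ → Who}
    (h : IsRun (RdvStep M m) (rdvTrace m a 0) n cs ls) :
    n ≤ 10 ∧ (∀ i ≤ n, cs i = rdvTrace m a i) ∧ ∀ i < n, ls i = rdvOrder i := by
  obtain ⟨h0, hstep⟩ := h
  have key : ∀ i ≤ n, i ≤ 10 ∧ cs i = rdvTrace m a i := by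
    intro i
    induction i with
    | zero => exact fun _ => ⟨by omega, h0⟩
    | succ i ih =>
      intro hi
      obtain ⟨hi10, hci⟩ := ih (by omega)
      have hs := hstep i hi
      rw [hci] at hs
      obtain ⟨hlt, -, hc⟩ := hs.eq_of_rdvTrace hi10
      exact ⟨hlt, hc⟩
  refine ⟨(key n le_rfl).1, fun i hi => (key i hi).2, fun i hi => ?_⟩
  have hs := hstep i hi
  rw [(key i hi.le).2] at hs
  exact (hs.eq_of_rdvTrace (key i hi.le).1).2.1

theorem IsRun.length_eq_ten_of_maximal {M : Type} {m a : M} {n : ℕ} {cs : ℕ → RdvCfg M}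
    {ls : ℕ → Who} (h : IsRun (RdvStep M m) (rdvTrace m a 0) n cs ls)
    (hmax : ¬ ∃ (w : Who) (c' : RdvCfg M), RdvStep M m (cs n) w c') : n = 10 := by
  obtain ⟨hn, hcs, -⟩ := h.eq_rdvTrace
  by_contra hne
  refine hmax ⟨rdvOrder n, rdvTrace m a (n + 1), ?_⟩
  rw [hcs n le_rfl]
  exact rdvStep_rdvTrace m a (by omega)

/-- From every configuration `(s0, s0', d)` with
`d l1 = d l2 = 0`:  (i) there is exactly one maximal interleaved run — it has length
`10`, its transitions fire in the order `rdvOrder` (i.e. `l1←1` by `γ₂`, then the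
guard `l1=1`, `x←m`, `l2←1` by `γ₁`, then the guards `l2=1`, `x=m` and `l1←0` by
`γ₂`, then the guard `l1=0` and `l2←0` by `γ₁`, then the guard `l2=0` by `γ₂`), and
any two maximal runs coincide; and (ii) in every interleaved run in which `γ₂`
reaches `s5'`, `γ₁` reaches `s5`, and the guard `x=m` (the `γ₂`-step from `s2'`) is
fired after the assignment `x←m` (the `γ₁`-step from `s1`). -/
theorem rendezvous_unique_interleaving
    {M : Type} (m : M) (c0 : RdvCfg M)
    (hg1 : c0.g1 = 0) (hg2 : c0.g2 = 0) (hl1 : c0.l1 = false) (hl2 : c0.l2 = false) :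
    -- (i) existence of the maximal run with the stated order of transitions
    (∃ (cs : ℕ → RdvCfg M) (ls : ℕ → Who),
      IsRun (RdvStep M m) c0 10 cs ls ∧
      (¬ ∃ (w : Who) (c' : RdvCfg M), RdvStep M m (cs 10) w c') ∧
      ∀ i < 10, ls i = rdvOrder i) ∧
    -- (i) every maximal run has length 10 and fires the transitions in that order
    (∀ (n : ℕ) (cs : ℕ → RdvCfg M) (ls : ℕ → Who),
      IsRun (RdvStep M m) c0 n cs ls →
      (¬ ∃ (w : Who) (c' : RdvCfg M), RdvStep M m (cs n) w c') →
      n = 10 ∧ ∀ i < 10, ls i = rdvOrder i) ∧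
    -- (i) uniqueness: any two maximal runs coincide
    (∀ (n : ℕ) (cs : ℕ → RdvCfg M) (ls : ℕ → Who)
        (n' : ℕ) (cs' : ℕ → RdvCfg M) (ls' : ℕ → Who),
      IsRun (RdvStep M m) c0 n cs ls →
      (¬ ∃ (w : Who) (c' : RdvCfg M), RdvStep M m (cs n) w c') →
      IsRun (RdvStep M m) c0 n' cs' ls' →
      (¬ ∃ (w : Who) (c' : RdvCfg M), RdvStep M m (cs' n') w c') →
      n = n' ∧ (∀ i ≤ n, cs i = cs' i) ∧ ∀ i < n, ls i = ls' i) ∧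
    -- (ii)
    (∀ (n : ℕ) (cs : ℕ → RdvCfg M) (ls : ℕ → Who),
      IsRun (RdvStep M m) c0 n cs ls → (cs n).g2 = 5 →
      (cs n).g1 = 5 ∧
      ∃ i j, i < n ∧ j < n ∧ i < j ∧
        (ls i = Who.p1 ∧ (cs i).g1 = 1) ∧
        (ls j = Who.p2 ∧ (cs j).g2 = 2)) := by
  obtain ⟨g1, g2, l1, l2, a⟩ := c0
  dsimp only at hg1 hg2 hl1 hl2
  subst hg1 hg2 hl1 hl2
  rw [show RdvCfg.mk 0 0 false false a = rdvTrace m a 0 from rfl]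
  refine ⟨⟨rdvTrace m a, rdvOrder, ⟨rfl, fun i hi => rdvStep_rdvTrace m a hi⟩, ?_,
    fun _ _ => rfl⟩, ?_, ?_, ?_⟩
  · rintro ⟨w, c, h⟩
    exact absurd (h.eq_of_rdvTrace le_rfl).1 (lt_irrefl _)
  · intro n cs ls h hmax
    obtain rfl := h.length_eq_ten_of_maximal hmax
    exact ⟨rfl, h.eq_rdvTrace.2.2⟩
  · intro n cs ls n' cs' ls' h hmax h' hmax'
    obtain rfl := h.length_eq_ten_of_maximal hmax
    obtain rfl := h'.length_eq_ten_of_maximal hmax'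
    obtain ⟨-, hc, hl⟩ := h.eq_rdvTrace
    obtain ⟨-, hc', hl'⟩ := h'.eq_rdvTrace
    exact ⟨rfl, fun i hi => (hc i hi).trans (hc' i hi).symm,
      fun i hi => (hl i hi).trans (hl' i hi).symm⟩
  · intro n cs ls h h5
    obtain ⟨hn, hc, hl⟩ := h.eq_rdvTrace
    obtain rfl : n = 10 := by
      rw [hc n le_rfl] at h5
      interval_cases n <;> simp_all [rdvTrace]
    refine ⟨by rw [hc 10 le_rfl]; rfl, 2, 5, by omega, by omega, by omega, ⟨?_, ?_⟩, ?_, ?_⟩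
    · rw [hl 2 (by omega)]; rfl
    · rw [hc 2 (by omega)]; rfl
    · rw [hl 5 (by omega)]; rfl
    · rw [hc 5 (by omega)]; rfl
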